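/- arXiv:1206.5386 — 7 statements merged into one kernel-verified Lean document; each statement's English description precedes it below -/
import Mathlib

section
/- Elaboration Type Soundness: If Γ ⊢ e : A ↪ M is derivable in the elaboration typing system, then |Γ| ⊢ M : |A| is derivable in the target type system, where |·| is the type translation. -/
/- Formalization of the source language (with merges, intersections, unions),
   the target language (STLC with unit, products, sums, fix),
   subtyping, (elaboration) typing, and operational semantics,
   following Dunfield, "Elaborating Intersection and Union Types".
   Variables use de Bruijn indices; contexts are lists with index 0 innermost. -/

namespace Elaboration

/-- Source types: ⊤, A → B, A ∧ B, A ∨ B -/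
inductive STy : Type
| top : STy
| arr : STy → STy → STy
| inter : STy → STy → STy
| union : STy → STy → STy

/-- Source expressions (de Bruijn indices) -/
inductive SExp : Type
| var : Nat → SExp
| unit : SExp
| lam : SExp → SExp
| app : SExp → SExp → SExp
| fixp : SExp → SExp
| merge : SExp → SExp → SExp

/-- Source values: x, (), λx.e, v₁,,v₂ -/
inductive SValue : SExp → Prop
| var {n} : SValue (.var n)
| unit : SValue .unit
| lam {e} : SValue (.lam e)
| merge {v1 v2} : SValue v1 → SValue v2 → SValue (.merge v1 v2)

/-- Shift (by one) the free variables ≥ c -/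
def SExp.shiftAbove (c : Nat) : SExp → SExp
| .var n => .var (if n < c then n else n + 1)
| .unit => .unit
| .lam e => .lam (e.shiftAbove (c+1))
| .app e1 e2 => .app (e1.shiftAbove c) (e2.shiftAbove c)
| .fixp e => .fixp (e.shiftAbove (c+1))
| .merge e1 e2 => .merge (e1.shiftAbove c) (e2.shiftAbove c)

/-- Capture-avoiding substitution `[s / k] e` -/
def SExp.subst (k : Nat) (s : SExp) : SExp → SExp
| .var n => if n < k then .var n else if n = k then s else .var (n - 1)
| .unit => .unit
| .lam e => .lam (SExp.subst (k+1) (s.shiftAbove 0) e)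
| .app e1 e2 => .app (SExp.subst k s e1) (SExp.subst k s e2)
| .fixp e => .fixp (SExp.subst (k+1) (s.shiftAbove 0) e)
| .merge e1 e2 => .merge (SExp.subst k s e1) (SExp.subst k s e2)

/-- Source small-step reduction: call-by-value plus the merge rules -/
inductive SStep : SExp → SExp → Prop
| app1 {e1 e1' e2} : SStep e1 e1' → SStep (.app e1 e2) (.app e1' e2)
| app2 {v1 e2 e2'} : SValue v1 → SStep e2 e2' → SStep (.app v1 e2) (.app v1 e2')
| beta {e v} : SValue v → SStep (.app (.lam e) v) (SExp.subst 0 v e)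
| fixp {e} : SStep (.fixp e) (SExp.subst 0 (.fixp e) e)
| unmergeL {e1 e2} : SStep (.merge e1 e2) e1
| unmergeR {e1 e2} : SStep (.merge e1 e2) e2
| merge1 {e1 e1' e2} : SStep e1 e1' → SStep (.merge e1 e2) (.merge e1' e2)
| merge2 {e1 e2 e2'} : SStep e2 e2' → SStep (.merge e1 e2) (.merge e1 e2')
| split {e} : SStep e (.merge e e)

/-- Multi-step source reduction e ⇝* e' -/
def SSteps : SExp → SExp → Prop := Relation.ReflTransGen SStep

/-- Evaluation contexts 𝓔 ::= [] | 𝓔 e | v 𝓔 | 𝓔,,e | e,,𝓔 -/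
inductive ECtx : Type
| hole : ECtx
| appL : ECtx → SExp → ECtx
| appR : SExp → ECtx → ECtx
| mergeL : ECtx → SExp → ECtx
| mergeR : SExp → ECtx → ECtx

/-- Well-formedness: in `v 𝓔`, the function part must be a value -/
inductive ECtx.Wf : ECtx → Prop
| hole : ECtx.Wf .hole
| appL {E e} : ECtx.Wf E → ECtx.Wf (.appL E e)
| appR {v E} : SValue v → ECtx.Wf E → ECtx.Wf (.appR v E)
| mergeL {E e} : ECtx.Wf E → ECtx.Wf (.mergeL E e)
| mergeR {e E} : ECtx.Wf E → ECtx.Wf (.mergeR e E)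

/-- Plug an expression into the hole: 𝓔[e] -/
def ECtx.fill : ECtx → SExp → SExp
| .hole, e => e
| .appL E e2, e => .app (E.fill e) e2
| .appR v E, e => .app v (E.fill e)
| .mergeL E e2, e => .merge (E.fill e) e2
| .mergeR e1 E, e => .merge e1 (E.fill e)

/-- Shift the free variables of the expressions embedded in an evaluation context
    (used when moving a context under one extra binding). -/
def ECtx.shift : ECtx → ECtx
| .hole => .hole
| .appL E e2 => .appL E.shift (e2.shiftAbove 0)
| .appR v E => .appR (v.shiftAbove 0) E.shift
| .mergeL E e2 => .mergeL E.shift (e2.shiftAbove 0)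
| .mergeR e1 E => .mergeR (e1.shiftAbove 0) E.shift

/-- Source subtyping A ≤ B -/
inductive Sub : STy → STy → Prop
| arr {A1 A2 B1 B2} : Sub B1 A1 → Sub A2 B2 → Sub (.arr A1 A2) (.arr B1 B2)
| topR {A} : Sub A .top
| interL1 {A1 A2 B} : Sub A1 B → Sub (.inter A1 A2) B
| interL2 {A1 A2 B} : Sub A2 B → Sub (.inter A1 A2) B
| interR {A B1 B2} : Sub A B1 → Sub A B2 → Sub A (.inter B1 B2)
| unionL {A1 A2 B} : Sub A1 B → Sub A2 B → Sub (.union A1 A2) B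
| unionR1 {A B1 B2} : Sub A B1 → Sub A (.union B1 B2)
| unionR2 {A B1 B2} : Sub A B2 → Sub A (.union B1 B2)

/-- Source typing Γ ⊢ e : A.  The two Boolean parameters control whether the
    rules `sub` (subsumption) and `direct` are available:
    `SrcTy true true` is the full system, `SrcTy false true` is the system
    without `sub`, `SrcTy false false` also omits `direct`. -/
inductive SrcTy : Bool → Bool → List STy → SExp → STy → Prop
| var {s d n A} {Γ : List STy} : Γ[n]? = some A → SrcTy s d Γ (.var n) A
| merge1 {s d Γ e1 e2 A} : SrcTy s d Γ e1 A → SrcTy s d Γ (.merge e1 e2) A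
| merge2 {s d Γ e1 e2 A} : SrcTy s d Γ e2 A → SrcTy s d Γ (.merge e1 e2) A
| fixp {s d Γ e A} : SrcTy s d (A :: Γ) e A → SrcTy s d Γ (.fixp e) A
| topI {s d Γ v} : SValue v → SrcTy s d Γ v .top
| arrI {s d Γ e A B} : SrcTy s d (A :: Γ) e B → SrcTy s d Γ (.lam e) (.arr A B)
| arrE {s d Γ e1 e2 A B} : SrcTy s d Γ e1 (.arr A B) → SrcTy s d Γ e2 A →
    SrcTy s d Γ (.app e1 e2) B
| interI {s d Γ e A1 A2} : SrcTy s d Γ e A1 → SrcTy s d Γ e A2 →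
    SrcTy s d Γ e (.inter A1 A2)
| interE1 {s d Γ e A1 A2} : SrcTy s d Γ e (.inter A1 A2) → SrcTy s d Γ e A1
| interE2 {s d Γ e A1 A2} : SrcTy s d Γ e (.inter A1 A2) → SrcTy s d Γ e A2
| unionI1 {s d Γ e A1 A2} : SrcTy s d Γ e A1 → SrcTy s d Γ e (.union A1 A2)
| unionI2 {s d Γ e A1 A2} : SrcTy s d Γ e A2 → SrcTy s d Γ e (.union A1 A2)
| unionE {s d Γ E e0 A1 A2 C} : ECtx.Wf E → SrcTy s d Γ e0 (.union A1 A2) →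
    SrcTy s d (A1 :: Γ) (E.shift.fill (.var 0)) C →
    SrcTy s d (A2 :: Γ) (E.shift.fill (.var 0)) C →
    SrcTy s d Γ (E.fill e0) C
| direct {s Γ E e0 A C} : ECtx.Wf E → SrcTy s true Γ e0 A →
    SrcTy s true (A :: Γ) (E.shift.fill (.var 0)) C →
    SrcTy s true Γ (E.fill e0) C
| sub {d Γ e A B} : SrcTy true d Γ e A → Sub A B → SrcTy true d Γ e B

/-- Target types: unit, T→T, T*T, T+T -/
inductive TTy : Type
| unit : TTy
| arr : TTy → TTy → TTy
| prod : TTy → TTy → TTy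
| sum : TTy → TTy → TTy

/-- Target terms (de Bruijn); `wcase M N1 N2` is `case M of inj₁ x₁ ⇒ N₁ ∥ inj₂ x₂ ⇒ N₂`
    where N1 and N2 each bind one variable. -/
inductive TExp : Type
| var : Nat → TExp
| unit : TExp
| lam : TExp → TExp
| app : TExp → TExp → TExp
| fixp : TExp → TExp
| pair : TExp → TExp → TExp
| proj1 : TExp → TExp
| proj2 : TExp → TExp
| inj1 : TExp → TExp
| inj2 : TExp → TExp
| wcase : TExp → TExp → TExp → TExp

/-- Target values -/
inductive TValue : TExp → Prop
| var {n} : TValue (.var n)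
| unit : TValue .unit
| lam {M} : TValue (.lam M)
| pair {W1 W2} : TValue W1 → TValue W2 → TValue (.pair W1 W2)
| inj1 {W} : TValue W → TValue (.inj1 W)
| inj2 {W} : TValue W → TValue (.inj2 W)

def TExp.shiftAbove (c : Nat) : TExp → TExp
| .var n => .var (if n < c then n else n + 1)
| .unit => .unit
| .lam M => .lam (M.shiftAbove (c+1))
| .app M N => .app (M.shiftAbove c) (N.shiftAbove c)
| .fixp M => .fixp (M.shiftAbove (c+1))
| .pair M1 M2 => .pair (M1.shiftAbove c) (M2.shiftAbove c)
| .proj1 M => .proj1 (M.shiftAbove c)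
| .proj2 M => .proj2 (M.shiftAbove c)
| .inj1 M => .inj1 (M.shiftAbove c)
| .inj2 M => .inj2 (M.shiftAbove c)
| .wcase M N1 N2 => .wcase (M.shiftAbove c) (N1.shiftAbove (c+1)) (N2.shiftAbove (c+1))

/-- Capture-avoiding substitution `[s / k] M` -/
def TExp.subst (k : Nat) (s : TExp) : TExp → TExp
| .var n => if n < k then .var n else if n = k then s else .var (n - 1)
| .unit => .unit
| .lam M => .lam (TExp.subst (k+1) (s.shiftAbove 0) M)
| .app M N => .app (TExp.subst k s M) (TExp.subst k s N)
| .fixp M => .fixp (TExp.subst (k+1) (s.shiftAbove 0) M)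
| .pair M1 M2 => .pair (TExp.subst k s M1) (TExp.subst k s M2)
| .proj1 M => .proj1 (TExp.subst k s M)
| .proj2 M => .proj2 (TExp.subst k s M)
| .inj1 M => .inj1 (TExp.subst k s M)
| .inj2 M => .inj2 (TExp.subst k s M)
| .wcase M N1 N2 => .wcase (TExp.subst k s M)
    (TExp.subst (k+1) (s.shiftAbove 0) N1) (TExp.subst (k+1) (s.shiftAbove 0) N2)

/-- Target call-by-value small-step reduction M ↦ M' -/
inductive TStep : TExp → TExp → Prop
| app1 {M1 M1' M2} : TStep M1 M1' → TStep (.app M1 M2) (.app M1' M2)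
| app2 {W1 M2 M2'} : TValue W1 → TStep M2 M2' → TStep (.app W1 M2) (.app W1 M2')
| beta {M W} : TValue W → TStep (.app (.lam M) W) (TExp.subst 0 W M)
| fixp {M} : TStep (.fixp M) (TExp.subst 0 (.fixp M) M)
| pair1 {M1 M1' M2} : TStep M1 M1' → TStep (.pair M1 M2) (.pair M1' M2)
| pair2 {W1 M2 M2'} : TValue W1 → TStep M2 M2' → TStep (.pair W1 M2) (.pair W1 M2')
| proj1Cong {M M'} : TStep M M' → TStep (.proj1 M) (.proj1 M')
| proj2Cong {M M'} : TStep M M' → TStep (.proj2 M) (.proj2 M')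
| proj1Beta {W1 W2} : TValue W1 → TValue W2 → TStep (.proj1 (.pair W1 W2)) W1
| proj2Beta {W1 W2} : TValue W1 → TValue W2 → TStep (.proj2 (.pair W1 W2)) W2
| inj1Cong {M M'} : TStep M M' → TStep (.inj1 M) (.inj1 M')
| inj2Cong {M M'} : TStep M M' → TStep (.inj2 M) (.inj2 M')
| caseCong {M M' N1 N2} : TStep M M' → TStep (.wcase M N1 N2) (.wcase M' N1 N2)
| caseInj1 {W N1 N2} : TValue W → TStep (.wcase (.inj1 W) N1 N2) (TExp.subst 0 W N1)
| caseInj2 {W N1 N2} : TValue W → TStep (.wcase (.inj2 W) N1 N2) (TExp.subst 0 W N2)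

/-- Multi-step target reduction M ↦* M' -/
def TSteps : TExp → TExp → Prop := Relation.ReflTransGen TStep

/-- Target typing G ⊢ M : T (standard STLC with unit, products, sums, fix) -/
inductive TgtTy : List TTy → TExp → TTy → Prop
| var {n T} {G : List TTy} : G[n]? = some T → TgtTy G (.var n) T
| unit {G} : TgtTy G .unit .unit
| lam {G M T1 T2} : TgtTy (T1 :: G) M T2 → TgtTy G (.lam M) (.arr T1 T2)
| app {G M1 M2 T T'} : TgtTy G M1 (.arr T T') → TgtTy G M2 T → TgtTy G (.app M1 M2) T'
| fixp {G M T} : TgtTy (T :: G) M T → TgtTy G (.fixp M) T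
| pair {G M1 M2 T1 T2} : TgtTy G M1 T1 → TgtTy G M2 T2 → TgtTy G (.pair M1 M2) (.prod T1 T2)
| proj1 {G M T1 T2} : TgtTy G M (.prod T1 T2) → TgtTy G (.proj1 M) T1
| proj2 {G M T1 T2} : TgtTy G M (.prod T1 T2) → TgtTy G (.proj2 M) T2
| inj1 {G M T1 T2} : TgtTy G M T1 → TgtTy G (.inj1 M) (.sum T1 T2)
| inj2 {G M T1 T2} : TgtTy G M T2 → TgtTy G (.inj2 M) (.sum T1 T2)
| wcase {G M N1 N2 T1 T2 T} : TgtTy G M (.sum T1 T2) →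
    TgtTy (T1 :: G) N1 T → TgtTy (T2 :: G) N2 T → TgtTy G (.wcase M N1 N2) T

/-- Type translation |A| : |⊤| = unit, |A→B| = |A|→|B|, |A∧B| = |A|*|B|, |A∨B| = |A|+|B| -/
def tytrans : STy → TTy
| .top => .unit
| .arr A B => .arr (tytrans A) (tytrans B)
| .inter A B => .prod (tytrans A) (tytrans B)
| .union A B => .sum (tytrans A) (tytrans B)

/-- Elaboration typing Γ ⊢ e : A ↪ M -/
inductive Elab : List STy → SExp → STy → TExp → Prop
| var {n A} {Γ : List STy} : Γ[n]? = some A → Elab Γ (.var n) A (.var n)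
| merge1 {Γ e1 e2 A M} : Elab Γ e1 A M → Elab Γ (.merge e1 e2) A M
| merge2 {Γ e1 e2 A M} : Elab Γ e2 A M → Elab Γ (.merge e1 e2) A M
| fixp {Γ e A M} : Elab (A :: Γ) e A M → Elab Γ (.fixp e) A (.fixp M)
| topI {Γ v} : SValue v → Elab Γ v .top .unit
| arrI {Γ e A B M} : Elab (A :: Γ) e B M → Elab Γ (.lam e) (.arr A B) (.lam M)
| arrE {Γ e1 e2 A B M1 M2} : Elab Γ e1 (.arr A B) M1 → Elab Γ e2 A M2 →
    Elab Γ (.app e1 e2) B (.app M1 M2)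
| interI {Γ e A1 A2 M1 M2} : Elab Γ e A1 M1 → Elab Γ e A2 M2 →
    Elab Γ e (.inter A1 A2) (.pair M1 M2)
| interE1 {Γ e A1 A2 M} : Elab Γ e (.inter A1 A2) M → Elab Γ e A1 (.proj1 M)
| interE2 {Γ e A1 A2 M} : Elab Γ e (.inter A1 A2) M → Elab Γ e A2 (.proj2 M)
| unionI1 {Γ e A1 A2 M} : Elab Γ e A1 M → Elab Γ e (.union A1 A2) (.inj1 M)
| unionI2 {Γ e A2 A1 M} : Elab Γ e A2 M → Elab Γ e (.union A1 A2) (.inj2 M)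
| unionE {Γ E e0 A1 A2 C M0 N1 N2} : ECtx.Wf E → Elab Γ e0 (.union A1 A2) M0 →
    Elab (A1 :: Γ) (E.shift.fill (.var 0)) C N1 →
    Elab (A2 :: Γ) (E.shift.fill (.var 0)) C N2 →
    Elab Γ (E.fill e0) C (.wcase M0 N1 N2)
| direct {Γ E e0 A C M0 N} : ECtx.Wf E → Elab Γ e0 A M0 →
    Elab (A :: Γ) (E.shift.fill (.var 0)) C N →
    Elab Γ (E.fill e0) C (.app (.lam N) M0)


/-- Elaboration Type Soundness -/
theorem elab_type_soundness (Γ : List STy) (e : SExp) (A : STy) (M : TExp)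
    (h : Elab Γ e A M) : TgtTy (Γ.map tytrans) M (tytrans A) := by
  induction h with
  | var hn => exact .var (by simp [hn])
  | merge1 _ ih => exact ih
  | merge2 _ ih => exact ih
  | fixp _ ih => exact .fixp ih
  | topI _ => exact .unit
  | arrI _ ih => exact .lam ih
  | arrE _ _ ih₁ ih₂ => exact .app ih₁ ih₂
  | interI _ _ ih₁ ih₂ => exact .pair ih₁ ih₂
  | interE1 _ ih => exact .proj1 ih
  | interE2 _ ih => exact .proj2 ih
  | unionI1 _ ih => exact .inj1 ih
  | unionI2 _ ih => exact .inj2 ih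
  | unionE _ _ _ _ ih₀ ih₁ ih₂ => exact .wcase ih₀ ih₁ ih₂
  | direct _ _ _ ih₀ ih₁ => exact .app (.lam ih₁) ih₀

end Elaboration
end

section
/- Unions/Injections inversion: If Γ ⊢ e : A₁ ∨ A₂ ↪ injₖ M₀ is derivable in the elaboration typing system (for k∈{1,2}), then Γ ⊢ e : Aₖ ↪ M₀ is derivable. -/
/- Formalization of the source language (with merges, intersections, unions),
   the target language (STLC with unit, products, sums, fix),
   subtyping, (elaboration) typing, and operational semantics,
   following Dunfield, "Elaborating Intersection and Union Types".
   Variables use de Bruijn indices; contexts are lists with index 0 innermost. -/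

namespace Elaboration

theorem Elab.of_union_inj1 {Γ : List STy} {e : SExp} {A1 A2 : STy} {M0 : TExp}
    (h : Elab Γ e (.union A1 A2) (.inj1 M0)) : Elab Γ e A1 M0 := by
  generalize hA : STy.union A1 A2 = A at h
  generalize hM : TExp.inj1 M0 = M at h
  induction h with
  | merge1 _ ih => exact .merge1 (ih hA hM)
  | merge2 _ ih => exact .merge2 (ih hA hM)
  | unionI1 h =>
    cases hA
    cases hM
    exact h
  | _ => cases hM

theorem Elab.of_union_inj2 {Γ : List STy} {e : SExp} {A1 A2 : STy} {M0 : TExp}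
    (h : Elab Γ e (.union A1 A2) (.inj2 M0)) : Elab Γ e A2 M0 := by
  generalize hA : STy.union A1 A2 = A at h
  generalize hM : TExp.inj2 M0 = M at h
  induction h with
  | merge1 _ ih => exact .merge1 (ih hA hM)
  | merge2 _ ih => exact .merge2 (ih hA hM)
  | unionI2 h =>
    cases hA
    cases hM
    exact h
  | _ => cases hM

/-- STATEMENT 7 (Unions/Injections inversion), stated for both k=1 and k=2 -/
theorem elab_union_inversion (Γ : List STy) (e : SExp) (A1 A2 : STy) (M0 : TExp) :
    (Elab Γ e (.union A1 A2) (.inj1 M0) → Elab Γ e A1 M0) ∧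
    (Elab Γ e (.union A1 A2) (.inj2 M0) → Elab Γ e A2 M0) :=
  ⟨Elab.of_union_inj1, Elab.of_union_inj2⟩

end Elaboration
end

section
/- Intersections/Pairs inversion: If Γ ⊢ e : A₁ ∧ A₂ ↪ ⟨M₁,M₂⟩ is derivable in the elaboration typing system, then there exist source expressions e₁' and e₂' such that (1) e ⇝* e₁' and Γ ⊢ e₁' : A₁ ↪ M₁, and (2) e ⇝* e₂' and Γ ⊢ e₂' : A₂ ↪ M₂. -/
/- Formalization of the source language (with merges, intersections, unions),
   the target language (STLC with unit, products, sums, fix),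
   subtyping, (elaboration) typing, and operational semantics,
   following Dunfield, "Elaborating Intersection and Union Types".
   Variables use de Bruijn indices; contexts are lists with index 0 innermost. -/

namespace Elaboration

/-- Intersections/Pairs inversion -/
theorem elab_inter_inversion (Γ : List STy) (e : SExp) (A1 A2 : STy) (M1 M2 : TExp)
    (h : Elab Γ e (.inter A1 A2) (.pair M1 M2)) :
    (∃ e1' : SExp, SSteps e e1' ∧ Elab Γ e1' A1 M1) ∧
    (∃ e2' : SExp, SSteps e e2' ∧ Elab Γ e2' A2 M2) := by
  generalize hA : STy.inter A1 A2 = A at h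
  generalize hM : TExp.pair M1 M2 = M at h
  induction h with
  | merge1 _ ih =>
    obtain ⟨⟨e1', s1, t1⟩, ⟨e2', s2, t2⟩⟩ := ih hA hM
    exact ⟨⟨e1', .head .unmergeL s1, t1⟩, ⟨e2', .head .unmergeL s2, t2⟩⟩
  | merge2 _ ih =>
    obtain ⟨⟨e1', s1, t1⟩, ⟨e2', s2, t2⟩⟩ := ih hA hM
    exact ⟨⟨e1', .head .unmergeR s1, t1⟩, ⟨e2', .head .unmergeR s2, t2⟩⟩
  | interI t1 t2 =>
    cases hA
    cases hM
    exact ⟨⟨_, .refl, t1⟩, ⟨_, .refl, t2⟩⟩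
  | _ => cases hM

end Elaboration
end

section
/- Arrows/Lambdas inversion: If · ⊢ e : A → B ↪ λx.M₀ is derivable in the elaboration typing system (empty context), then there exists a source expression e₀ such that e ⇝* λx.e₀ and x:A ⊢ e₀ : B ↪ M₀ is derivable. -/
/- Formalization of the source language (with merges, intersections, unions),
   the target language (STLC with unit, products, sums, fix),
   subtyping, (elaboration) typing, and operational semantics,
   following Dunfield, "Elaborating Intersection and Union Types".
   Variables use de Bruijn indices; contexts are lists with index 0 innermost. -/

namespace Elaboration

/-- Arrows/Lambdas inversion -/
theorem elab_arr_inversion (e : SExp) (A B : STy) (M0 : TExp)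
    (h : Elab [] e (.arr A B) (.lam M0)) :
    ∃ e0 : SExp, SSteps e (.lam e0) ∧ Elab [A] e0 B M0 := by
  generalize hC : STy.arr A B = C at h
  generalize hM : TExp.lam M0 = M at h
  generalize hΓ : ([] : List STy) = Γ at h
  induction h with
  | arrI h =>
    cases hC; cases hM; cases hΓ
    exact ⟨_, .refl, h⟩
  | merge1 _ ih =>
    obtain ⟨e0, hs, he⟩ := ih hC hM hΓ
    exact ⟨e0, .head .unmergeL hs, he⟩
  | merge2 _ ih =>
    obtain ⟨e0, hs, he⟩ := ih hC hM hΓ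
    exact ⟨e0, .head .unmergeR hs, he⟩
  | _ => cases hM

end Elaboration
end

section
/- Value monotonicity: If Γ ⊢ e : A ↪ W is derivable in the elaboration typing system, where W is a target value, then there exists a source value v such that e ⇝* v and Γ ⊢ v : A ↪ W is derivable. -/
/- Formalization of the source language (with merges, intersections, unions),
   the target language (STLC with unit, products, sums, fix),
   subtyping, (elaboration) typing, and operational semantics,
   following Dunfield, "Elaborating Intersection and Union Types".
   Variables use de Bruijn indices; contexts are lists with index 0 innermost. -/

namespace Elaboration

theorem SSteps.merge {e1 e1' e2 e2' : SExp} (h1 : SSteps e1 e1') (h2 : SSteps e2 e2') :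
    SSteps (.merge e1 e2) (.merge e1' e2') :=
  Relation.ReflTransGen.trans
    (Relation.ReflTransGen.lift (SExp.merge · e2) (fun _ _ h => SStep.merge1 h) _ _ h1)
    (Relation.ReflTransGen.lift (SExp.merge e1') (fun _ _ h => SStep.merge2 h) _ _ h2)

/-- Value monotonicity -/
theorem value_monotonicity (Γ : List STy) (e : SExp) (A : STy) (W : TExp)
    (hW : TValue W) (h : Elab Γ e A W) :
    ∃ v : SExp, SValue v ∧ SSteps e v ∧ Elab Γ v A W := by
  induction h with
  | var hn => exact ⟨_, .var, .refl, .var hn⟩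
  | merge1 _ ih =>
    obtain ⟨v, hv, hs, ht⟩ := ih hW
    exact ⟨v, hv, .head .unmergeL hs, ht⟩
  | merge2 _ ih =>
    obtain ⟨v, hv, hs, ht⟩ := ih hW
    exact ⟨v, hv, .head .unmergeR hs, ht⟩
  | topI hv => exact ⟨_, hv, .refl, .topI hv⟩
  | arrI h => exact ⟨_, .lam, .refl, .arrI h⟩
  | interI _ _ ih1 ih2 =>
    cases hW with
    | pair hW1 hW2 =>
      obtain ⟨v1, hv1, hs1, ht1⟩ := ih1 hW1
      obtain ⟨v2, hv2, hs2, ht2⟩ := ih2 hW2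
      exact ⟨.merge v1 v2, .merge hv1 hv2, .head .split (hs1.merge hs2),
        .interI (.merge1 ht1) (.merge2 ht2)⟩
  | unionI1 _ ih =>
    cases hW with
    | inj1 hW =>
      obtain ⟨v, hv, hs, ht⟩ := ih hW
      exact ⟨v, hv, hs, .unionI1 ht⟩
  | unionI2 _ ih =>
    cases hW with
    | inj2 hW =>
      obtain ⟨v, hv, hs, ht⟩ := ih hW
      exact ⟨v, hv, hs, .unionI2 ht⟩
  | _ => cases hW

end Elaboration
end

section
/- Substitution for elaboration: If Γ, x:A ⊢ e : B ↪ M is derivable in the elaboration typing system, and Γ ⊢ v : A ↪ W is derivable where v is a source value and W a target value, then Γ ⊢ [v/x]e : B ↪ [W/x]M is derivable. -/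
/- Formalization of the source language (with merges, intersections, unions),
   the target language (STLC with unit, products, sums, fix),
   subtyping, (elaboration) typing, and operational semantics,
   following Dunfield, "Elaborating Intersection and Union Types".
   Variables use de Bruijn indices; contexts are lists with index 0 innermost. -/

namespace Elaboration

theorem SExp.shiftAbove_shiftAbove (e : SExp) :
    ∀ {d c : Nat}, d ≤ c →
      (e.shiftAbove d).shiftAbove (c + 1) = (e.shiftAbove c).shiftAbove d := by
  induction e with
  | var n =>
    intro d c h
    simp only [SExp.shiftAbove, SExp.var.injEq]
    grind
  | unit => intros; rfl
  | lam e ih | fixp e ih =>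
    intro d c h
    simp only [SExp.shiftAbove, ih (Nat.succ_le_succ h)]
  | app e₁ e₂ ih₁ ih₂ | merge e₁ e₂ ih₁ ih₂ =>
    intro d c h
    simp only [SExp.shiftAbove, ih₁ h, ih₂ h]

theorem SExp.subst_shiftAbove (e : SExp) :
    ∀ {d k : Nat} (s : SExp), d ≤ k →
      SExp.subst (k + 1) (s.shiftAbove d) (e.shiftAbove d) =
        (SExp.subst k s e).shiftAbove d := by
  induction e with
  | var n =>
    intro d k s h
    simp only [SExp.shiftAbove, SExp.subst]
    split_ifs <;> grind [SExp.shiftAbove]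
  | unit => intros; rfl
  | lam e ih | fixp e ih =>
    intro d k s h
    simp only [SExp.shiftAbove, SExp.subst]
    rw [← s.shiftAbove_shiftAbove (Nat.zero_le d), ih _ (by omega)]
  | app e₁ e₂ ih₁ ih₂ | merge e₁ e₂ ih₁ ih₂ =>
    intro d k s h
    simp only [SExp.shiftAbove, SExp.subst, ih₁ s h, ih₂ s h]

theorem SValue.shiftAbove {v : SExp} (hv : SValue v) (c : Nat) : SValue (v.shiftAbove c) := by
  induction hv with
  | var => exact .var
  | unit => exact .unit
  | lam => exact .lam
  | merge _ _ ih₁ ih₂ => exact .merge ih₁ ih₂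

theorem SValue.subst {v s : SExp} (hv : SValue v) (hs : SValue s) (k : Nat) :
    SValue (SExp.subst k s v) := by
  induction hv with
  | var =>
    simp only [SExp.subst]
    split_ifs
    exacts [.var, hs, .var]
  | unit => exact .unit
  | lam => exact .lam
  | merge _ _ ih₁ ih₂ => exact .merge ih₁ ih₂

/-- Apply `f` to every expression embedded in an evaluation context. -/
def ECtx.map (f : SExp → SExp) : ECtx → ECtx
| .hole => .hole
| .appL E e => .appL (E.map f) (f e)
| .appR v E => .appR (f v) (E.map f)
| .mergeL E e => .mergeL (E.map f) (f e)
| .mergeR e E => .mergeR (f e) (E.map f)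

theorem ECtx.Wf.map {f : SExp → SExp} (hf : ∀ v, SValue v → SValue (f v)) {E : ECtx}
    (hE : E.Wf) : (E.map f).Wf := by
  induction hE with
  | hole => exact .hole
  | appL _ ih => exact .appL ih
  | appR hv _ ih => exact .appR (hf _ hv) ih
  | mergeL _ ih => exact .mergeL ih
  | mergeR _ ih => exact .mergeR ih

theorem ECtx.shiftAbove_fill (c : Nat) (E : ECtx) (e : SExp) :
    (E.fill e).shiftAbove c = (E.map (SExp.shiftAbove c)).fill (e.shiftAbove c) := by
  induction E <;> simp_all [ECtx.fill, ECtx.map, SExp.shiftAbove]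

theorem ECtx.subst_fill (k : Nat) (s : SExp) (E : ECtx) (e : SExp) :
    SExp.subst k s (E.fill e) = (E.map (SExp.subst k s)).fill (SExp.subst k s e) := by
  induction E <;> simp_all [ECtx.fill, ECtx.map, SExp.subst]

theorem ECtx.shiftAbove_shift_fill_var (c : Nat) (E : ECtx) :
    (E.shift.fill (.var 0)).shiftAbove (c + 1) =
      (E.map (SExp.shiftAbove c)).shift.fill (.var 0) := by
  induction E <;>
    simp_all [ECtx.fill, ECtx.map, ECtx.shift, SExp.shiftAbove, SExp.shiftAbove_shiftAbove]

theorem ECtx.subst_shift_fill_var (k : Nat) (s : SExp) (E : ECtx) :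
    SExp.subst (k + 1) (s.shiftAbove 0) (E.shift.fill (.var 0)) =
      (E.map (SExp.subst k s)).shift.fill (.var 0) := by
  induction E <;>
    simp_all [ECtx.fill, ECtx.map, ECtx.shift, SExp.subst, SExp.subst_shiftAbove]

/-- Weakening by one variable at index `c`. -/
theorem Elab.shiftAbove {Γ : List STy} {e : SExp} {A : STy} {M : TExp} (h : Elab Γ e A M) :
    ∀ (c : Nat) (Δ : List STy), (∀ n : Nat, Δ[if n < c then n else n + 1]? = Γ[n]?) →
      Elab Δ (e.shiftAbove c) A (M.shiftAbove c) := by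
  have lift : ∀ {c : Nat} {Γ Δ : List STy} (B : STy),
      (∀ n : Nat, Δ[if n < c then n else n + 1]? = Γ[n]?) →
      ∀ n : Nat, (B :: Δ)[if n < c + 1 then n else n + 1]? = (B :: Γ)[n]? := by
    intro c Γ Δ B hΔ n
    cases n with
    | zero => simp
    | succ n =>
      rw [List.getElem?_cons_succ, ← hΔ n]
      by_cases hn : n < c <;> simp [hn]
  induction h with
  | var h => intro c Δ hΔ; exact .var ((hΔ _).trans h)
  | merge1 _ ih => intro c Δ hΔ; exact .merge1 (ih c Δ hΔ)
  | merge2 _ ih => intro c Δ hΔ; exact .merge2 (ih c Δ hΔ)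
  | fixp _ ih => intro c Δ hΔ; exact .fixp (ih _ _ (lift _ hΔ))
  | topI hv => intro c Δ hΔ; exact .topI (hv.shiftAbove c)
  | arrI _ ih => intro c Δ hΔ; exact .arrI (ih _ _ (lift _ hΔ))
  | arrE _ _ ih₁ ih₂ => intro c Δ hΔ; exact .arrE (ih₁ c Δ hΔ) (ih₂ c Δ hΔ)
  | interI _ _ ih₁ ih₂ => intro c Δ hΔ; exact .interI (ih₁ c Δ hΔ) (ih₂ c Δ hΔ)
  | interE1 _ ih => intro c Δ hΔ; exact .interE1 (ih c Δ hΔ)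
  | interE2 _ ih => intro c Δ hΔ; exact .interE2 (ih c Δ hΔ)
  | unionI1 _ ih => intro c Δ hΔ; exact .unionI1 (ih c Δ hΔ)
  | unionI2 _ ih => intro c Δ hΔ; exact .unionI2 (ih c Δ hΔ)
  | unionE hE _ _ _ ih₀ ih₁ ih₂ =>
    intro c Δ hΔ
    rw [ECtx.shiftAbove_fill]
    refine .unionE (hE.map fun _ hv => hv.shiftAbove c) (ih₀ c Δ hΔ) ?_ ?_
    · rw [← ECtx.shiftAbove_shift_fill_var]
      exact ih₁ _ _ (lift _ hΔ)
    · rw [← ECtx.shiftAbove_shift_fill_var]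
      exact ih₂ _ _ (lift _ hΔ)
  | direct hE _ _ ih₀ ih₁ =>
    intro c Δ hΔ
    rw [ECtx.shiftAbove_fill]
    refine .direct (hE.map fun _ hv => hv.shiftAbove c) (ih₀ c Δ hΔ) ?_
    rw [← ECtx.shiftAbove_shift_fill_var]
    exact ih₁ _ _ (lift _ hΔ)

/-- `Δ` is `Γ` with the entry at index `k` removed, and `v` elaborates to `W` in `Δ` at the type
of that entry. -/
structure ElabSubst (k : Nat) (v : SExp) (W : TExp) (Γ Δ : List STy) : Prop where
  value : SValue v
  below : ∀ n < k, Δ[n]? = Γ[n]?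
  above : ∀ n, k ≤ n → Δ[n]? = Γ[n + 1]?
  typed : ∀ A, Γ[k]? = some A → Elab Δ v A W

theorem ElabSubst.cons {k : Nat} {v : SExp} {W : TExp} {Γ Δ : List STy}
    (h : ElabSubst k v W Γ Δ) (B : STy) :
    ElabSubst (k + 1) (v.shiftAbove 0) (W.shiftAbove 0) (B :: Γ) (B :: Δ) where
  value := h.value.shiftAbove 0
  below
    | 0, _ => rfl
    | n + 1, hn => h.below n (by omega)
  above
    | 0, hn => absurd hn (by omega)
    | n + 1, hn => h.above n (by omega)
  typed A hA := (h.typed A hA).shiftAbove 0 _ fun n => by simp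

theorem Elab.subst {Γ : List STy} {e : SExp} {B : STy} {M : TExp} (h : Elab Γ e B M) :
    ∀ {k : Nat} {v : SExp} {W : TExp} {Δ : List STy}, ElabSubst k v W Γ Δ →
      Elab Δ (SExp.subst k v e) B (TExp.subst k W M) := by
  induction h with
  | @var n A Γ h =>
    intro k v W Δ hs
    simp only [SExp.subst, TExp.subst]
    split_ifs with hlt heq
    · exact .var ((hs.below n hlt).trans h)
    · exact hs.typed A (heq ▸ h)
    · refine .var ((hs.above (n - 1) (by omega)).trans ?_)
      rwa [Nat.sub_add_cancel (by omega)]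
  | merge1 _ ih => intro k v W Δ hs; exact .merge1 (ih hs)
  | merge2 _ ih => intro k v W Δ hs; exact .merge2 (ih hs)
  | fixp _ ih => intro k v W Δ hs; exact .fixp (ih (hs.cons _))
  | topI hv => intro k v W Δ hs; exact .topI (hv.subst hs.value k)
  | arrI _ ih => intro k v W Δ hs; exact .arrI (ih (hs.cons _))
  | arrE _ _ ih₁ ih₂ => intro k v W Δ hs; exact .arrE (ih₁ hs) (ih₂ hs)
  | interI _ _ ih₁ ih₂ => intro k v W Δ hs; exact .interI (ih₁ hs) (ih₂ hs)
  | interE1 _ ih => intro k v W Δ hs; exact .interE1 (ih hs)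
  | interE2 _ ih => intro k v W Δ hs; exact .interE2 (ih hs)
  | unionI1 _ ih => intro k v W Δ hs; exact .unionI1 (ih hs)
  | unionI2 _ ih => intro k v W Δ hs; exact .unionI2 (ih hs)
  | unionE hE _ _ _ ih₀ ih₁ ih₂ =>
    intro k v W Δ hs
    rw [ECtx.subst_fill]
    refine .unionE (hE.map fun _ hv => hv.subst hs.value k) (ih₀ hs) ?_ ?_
    · rw [← ECtx.subst_shift_fill_var]
      exact ih₁ (hs.cons _)
    · rw [← ECtx.subst_shift_fill_var]
      exact ih₂ (hs.cons _)
  | direct hE _ _ ih₀ ih₁ =>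
    intro k v W Δ hs
    rw [ECtx.subst_fill]
    refine .direct (hE.map fun _ hv => hv.subst hs.value k) (ih₀ hs) ?_
    rw [← ECtx.subst_shift_fill_var]
    exact ih₁ (hs.cons _)

/-- Substitution for elaboration -/
theorem elab_substitution (Γ : List STy) (A B : STy) (e v : SExp) (M W : TExp)
    (he : Elab (A :: Γ) e B M) (hv : SValue v) (hW : TValue W)
    (hvW : Elab Γ v A W) :
    Elab Γ (SExp.subst 0 v e) B (TExp.subst 0 W M) := by
  exact he.subst
    { value := hv
      below := fun n hn => absurd hn (Nat.not_lt_zero n)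
      above := fun _ _ => rfl
      typed := fun _ hA => Option.some.inj hA ▸ hvW }

end Elaboration
end

section
/- Transitivity of source subtyping: For all source types A, B, C, if A ≤ B and B ≤ C are derivable, then A ≤ C is derivable. -/
/- Formalization of the source language (with merges, intersections, unions),
   the target language (STLC with unit, products, sums, fix),
   subtyping, (elaboration) typing, and operational semantics,
   following Dunfield, "Elaborating Intersection and Union Types".
   Variables use de Bruijn indices; contexts are lists with index 0 innermost. -/

namespace Elaboration

/-- Transitivity of source subtyping -/
theorem sub_trans (A B C : STy) (hAB : Sub A B) (hBC : Sub B C) : Sub A C := by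
  induction B generalizing A C with
  | top =>
    generalize hB : STy.top = B at hBC
    induction hBC with
    | topR => exact .topR
    | interR _ _ ih1 ih2 => exact .interR (ih1 hB) (ih2 hB)
    | unionR1 _ ih => exact .unionR1 (ih hB)
    | unionR2 _ ih => exact .unionR2 (ih hB)
    | _ => cases hB
  | arr B1 B2 ihB1 ihB2 =>
    generalize hB : STy.arr B1 B2 = B at hAB
    induction hAB with
    | arr hdom hcod ihdom ihcod =>
      clear ihdom ihcod
      cases hB
      generalize hB : STy.arr B1 B2 = B at hBC
      induction hBC with
      | arr hdom' hcod' =>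
        cases hB
        exact .arr (ihB1 _ _ hdom' hdom) (ihB2 _ _ hcod hcod')
      | topR => exact .topR
      | interR _ _ ih1 ih2 => exact .interR (ih1 hB) (ih2 hB)
      | unionR1 _ ih => exact .unionR1 (ih hB)
      | unionR2 _ ih => exact .unionR2 (ih hB)
      | _ => cases hB
    | interL1 _ ih => exact .interL1 (ih hB)
    | interL2 _ ih => exact .interL2 (ih hB)
    | unionL _ _ ih1 ih2 => exact .unionL (ih1 hB) (ih2 hB)
    | _ => cases hB
  | inter B1 B2 ihB1 ihB2 =>
    generalize hB : STy.inter B1 B2 = B at hAB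
    induction hAB with
    | interR hA1 hA2 ihA1 ihA2 =>
      clear ihA1 ihA2
      cases hB
      generalize hB : STy.inter B1 B2 = B at hBC
      induction hBC with
      | interL1 h => cases hB; exact ihB1 _ _ hA1 h
      | interL2 h => cases hB; exact ihB2 _ _ hA2 h
      | topR => exact .topR
      | interR _ _ ih1 ih2 => exact .interR (ih1 hB) (ih2 hB)
      | unionR1 _ ih => exact .unionR1 (ih hB)
      | unionR2 _ ih => exact .unionR2 (ih hB)
      | _ => cases hB
    | interL1 _ ih => exact .interL1 (ih hB)
    | interL2 _ ih => exact .interL2 (ih hB)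
    | unionL _ _ ih1 ih2 => exact .unionL (ih1 hB) (ih2 hB)
    | _ => cases hB
  | union B1 B2 ihB1 ihB2 =>
    have hB12 : Sub B1 C ∧ Sub B2 C := by
      clear hAB ihB1 ihB2
      generalize hB : STy.union B1 B2 = B at hBC
      induction hBC with
      | unionL h1 h2 => cases hB; exact ⟨h1, h2⟩
      | topR => exact ⟨.topR, .topR⟩
      | interR _ _ ih1 ih2 =>
        exact ⟨.interR (ih1 hB).1 (ih2 hB).1, .interR (ih1 hB).2 (ih2 hB).2⟩
      | unionR1 _ ih => exact ⟨.unionR1 (ih hB).1, .unionR1 (ih hB).2⟩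
      | unionR2 _ ih => exact ⟨.unionR2 (ih hB).1, .unionR2 (ih hB).2⟩
      | _ => cases hB
    generalize hB : STy.union B1 B2 = B at hAB
    induction hAB with
    | unionR1 h => cases hB; exact ihB1 _ _ h hB12.1
    | unionR2 h => cases hB; exact ihB2 _ _ h hB12.2
    | interL1 _ ih => exact .interL1 (ih hB)
    | interL2 _ ih => exact .interL2 (ih hB)
    | unionL _ _ ih1 ih2 => exact .unionL (ih1 hB) (ih2 hB)
    | _ => cases hB

end Elaboration
end
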